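/- For every integer m ≥ 1, let ξ'_m = m (m−1) ⋯ 3 2 1 1 (m+1) (m+2) ⋯ (2m) be the word of length 2m+1 consisting of m, m−1, …, 2, 1 in decreasing order, followed by a second copy of 1, followed by m+1, m+2, …, 2m in increasing order. Then the number of words u with fast(u) = ξ'_m and the number of words u with slow(u) = ξ'_m are both equal to 2m+1. -/

import Mathlib

lemma foldr_max_mem {w : List ℕ} (h : w ≠ []) : w.foldr max 0 ∈ w := by
  induction w with
  | nil => exact absurd rfl h
  | cons a l ih =>
    rcases eq_or_ne l [] with rfl | hl
    · simp
    · have hm := ih hl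
      simp only [List.foldr_cons]
      rcases max_choice a (l.foldr max 0) with h' | h' <;> rw [h']
      · exact List.mem_cons_self
      · exact List.mem_cons_of_mem _ hm

lemma headI_mem {α : Type*} [Inhabited α] {l : List α} (h : l ≠ []) : l.headI ∈ l := by
  cases l with
  | nil => exact absurd rfl h
  | cons a t => simp

/-- `blocks n w` is the list of maximal (possibly empty) blocks of `w`
separated by occurrences of the letter `n`; that is, if `n` occurs `k` times
in `w`, then `blocks n w = [A₁, A₂, …, A_{k+1}]` where `w = A₁ n A₂ n ⋯ n A_{k+1}`
and no `Aᵢ` contains the letter `n`. -/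
def blocks (n : ℕ) : List ℕ → List (List ℕ)
  | [] => [[]]
  | a :: l =>
    if a = n then [] :: blocks n l
    else (a :: (blocks n l).headI) :: (blocks n l).tail

lemma blocks_ne_nil (n : ℕ) (w : List ℕ) : blocks n w ≠ [] := by
  cases w with
  | nil => simp [blocks]
  | cons a l =>
    simp only [blocks]
    split <;> simp

lemma blocks_length {n : ℕ} {w : List ℕ} : ∀ {A : List ℕ}, A ∈ blocks n w →
    A.length + w.count n ≤ w.length := by
  induction w with
  | nil =>
    intro A hA
    simp only [blocks, List.mem_singleton] at hA
    subst hA; simp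
  | cons a l ih =>
    intro A hA
    by_cases h : a = n
    · subst h
      simp only [blocks, if_pos rfl] at hA
      have hcc : (a :: l).count a = l.count a + 1 := by simp
      cases hA with
      | head =>
        have := List.count_le_length (a := a) (l := l)
        simp only [List.length_nil, List.length_cons, hcc]
        omega
      | tail _ h1 =>
        have := ih h1
        simp only [List.length_cons, hcc]
        omega
    · simp only [blocks, if_neg h] at hA
      have hcc : (a :: l).count n = l.count n := by
        simp [List.count_cons, h]
      cases hA with
      | head =>
        have := ih (headI_mem (blocks_ne_nil n l))
        simp only [List.length_cons, hcc]
        omega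
      | tail _ h1 =>
        have := ih (List.mem_of_mem_tail h1)
        simp only [List.length_cons, hcc]
        omega

/-- The generalized stack-sorting map `fast` (the convention in which a letter may
sit on top of a copy of itself in the stack): `fast ε = ε`, and if
`w = A₁ n A₂ n ⋯ n A_{k+1}` where `n` is the largest letter of `w` (occurring
`k` times) and the `Aᵢ` contain only letters smaller than `n`, then
`fast w = fast A₁ ++ fast A₂ ++ ⋯ ++ fast A_{k+1} ++ n ⋯ n` (with `k` copies of `n`). -/
def fast (w : List ℕ) : List ℕ :=
  if h : w = [] then []
  else
    ((blocks (w.foldr max 0) w).attach.map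
      fun (A : {x // x ∈ blocks (w.foldr max 0) w}) =>
      have : A.1.length < w.length := by
        have h1 := blocks_length A.2
        have h2 : 0 < w.count (w.foldr max 0) :=
          List.count_pos_iff.mpr (foldr_max_mem h)
        omega
      fast A.1).flatten ++ List.replicate (w.count (w.foldr max 0)) (w.foldr max 0)
termination_by w.length

/-- The generalized stack-sorting map `slow` (the convention in which a letter may
not sit on top of a copy of itself in the stack): `slow ε = ε`, and if
`w = A₁ n A₂ n ⋯ n A_{k+1}` where `n` is the largest letter of `w` (occurring
`k` times) and the `Aᵢ` contain only letters smaller than `n`, then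
`slow w = slow A₁ ++ slow A₂ ++ [n] ++ slow A₃ ++ [n] ++ ⋯ ++ slow A_{k+1} ++ [n]`. -/
def slow (w : List ℕ) : List ℕ :=
  if h : w = [] then []
  else
    (have : (blocks (w.foldr max 0) w).headI.length < w.length := by
      have h1 := blocks_length (headI_mem (blocks_ne_nil (w.foldr max 0) w))
      have h2 : 0 < w.count (w.foldr max 0) :=
        List.count_pos_iff.mpr (foldr_max_mem h)
      omega
     slow (blocks (w.foldr max 0) w).headI) ++
    ((blocks (w.foldr max 0) w).tail.attach.map
      fun (A : {x // x ∈ (blocks (w.foldr max 0) w).tail}) =>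
      have : A.1.length < w.length := by
        have h1 := blocks_length (List.mem_of_mem_tail A.2)
        have h2 : 0 < w.count (w.foldr max 0) :=
          List.count_pos_iff.mpr (foldr_max_mem h)
        omega
      slow A.1 ++ [w.foldr max 0]).flatten
termination_by w.length

/-- The word `ξ'_m = m (m-1) ⋯ 3 2 1 1 (m+1) (m+2) ⋯ (2m)` of length `2m + 1`. -/
def xiWord (m : ℕ) : List ℕ :=
  ((List.range m).map fun i => m - i) ++ 1 :: ((List.range m).map fun i => m + 1 + i)

lemma le_foldr_max {w : List ℕ} {x : ℕ} (hx : x ∈ w) : x ≤ w.foldr max 0 := by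
  induction w with
  | nil => simp at hx
  | cons a l ih =>
    rcases List.mem_cons.1 hx with rfl | h
    · simp
    · exact (ih h).trans (by simp)

lemma foldr_max_append_cons {A B : List ℕ} {n : ℕ} (hA : ∀ x ∈ A, x < n) (hB : ∀ x ∈ B, x < n) :
    (A ++ n :: B).foldr max 0 = n := by
  apply le_antisymm
  · have h := foldr_max_mem (w := A ++ n :: B) (by simp)
    generalize (A ++ n :: B).foldr max 0 = M at h
    rcases List.mem_append.1 h with h | h
    · exact (hA _ h).le
    · rcases List.mem_cons.1 h with h | h
      · exact h.le
      · exact (hB _ h).le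
  · exact le_foldr_max (by simp)

lemma blocks_of_notMem {n : ℕ} {w : List ℕ} (h : n ∉ w) : blocks n w = [w] := by
  induction w with
  | nil => rfl
  | cons a l ih =>
    simp only [List.mem_cons, not_or] at h
    simp [blocks, ih h.2, Ne.symm h.1]

lemma blocks_append_cons {n : ℕ} {A B : List ℕ} (hA : n ∉ A) :
    blocks n (A ++ n :: B) = A :: blocks n B := by
  induction A with
  | nil => simp [blocks]
  | cons a l ih =>
    simp only [List.mem_cons, not_or] at hA
    simp [blocks, ih hA.2, Ne.symm hA.1]

lemma length_blocks (n : ℕ) (w : List ℕ) : (blocks n w).length = w.count n + 1 := by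
  induction w with
  | nil => rfl
  | cons a l ih =>
    by_cases h : a = n <;> simp [blocks, h, ih]

lemma flatten_blocks_perm (n : ℕ) (w : List ℕ) :
    ((blocks n w).flatten ++ List.replicate (w.count n) n).Perm w := by
  induction w with
  | nil => simp [blocks]
  | cons a l ih =>
    by_cases h : a = n
    · subst h
      simp only [blocks, if_true, List.flatten_cons, List.nil_append, List.count_cons_self,
        List.replicate_succ]
      exact List.perm_middle.trans (ih.cons a)
    · obtain ⟨b, t, hbt⟩ := List.exists_cons_of_ne_nil (blocks_ne_nil n l)
      simp only [hbt, List.flatten_cons] at ih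
      simpa [blocks, h, hbt] using ih

lemma headI_append_flatten_tail_blocks_perm (n : ℕ) (w : List ℕ) :
    ((blocks n w).headI ++ ((blocks n w).tail.map (· ++ [n])).flatten).Perm w := by
  obtain ⟨b, t, hbt⟩ := List.exists_cons_of_ne_nil (blocks_ne_nil n w)
  have hlen := length_blocks n w
  have hw := flatten_blocks_perm n w
  rw [hbt] at hlen hw ⊢
  have key : ∀ t : List (List ℕ),
      ((t.map (· ++ [n])).flatten).Perm (t.flatten ++ List.replicate t.length n) := by
    intro t
    induction t with
    | nil => simp
    | cons c t ih =>
      simp only [List.map_cons, List.flatten_cons, List.append_assoc, List.length_cons,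
        List.replicate_succ]
      exact (((ih.cons n).trans List.perm_middle.symm).append_left c)
  have hlen' : t.length = w.count n := by simpa using hlen
  refine List.Perm.trans ?_ hw
  simpa [hlen'] using (key t).append_left b

lemma flatten_map_perm {α β : Type*} {f g : α → List β} {l : List α}
    (h : ∀ a ∈ l, (f a).Perm (g a)) : ((l.map f).flatten).Perm (l.map g).flatten := by
  induction l with
  | nil => simp
  | cons a l ih =>
    simp only [List.map_cons, List.flatten_cons]
    exact (h a (by simp)).append (ih fun b hb => h b (by simp [hb]))

/-- The properties of a generalized stack-sorting map shared by `fast` and `slow`. -/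
structure IsStackSort (S : List ℕ → List ℕ) : Prop where
  nil : S [] = []
  perm : ∀ w, (S w).Perm w
  append_cons : ∀ {A B : List ℕ} {n : ℕ}, (∀ x ∈ A, x < n) → (∀ x ∈ B, x < n) →
    S (A ++ n :: B) = S A ++ S B ++ [n]
  concat_max : ∀ {w : List ℕ}, w ≠ [] → ∃ v, S w = v ++ [w.foldr max 0]
  pair : ∀ a, S [a, a] = [a, a]

lemma fast_of_ne_nil {w : List ℕ} (h : w ≠ []) :
    fast w = ((blocks (w.foldr max 0) w).map fast).flatten ++
      List.replicate (w.count (w.foldr max 0)) (w.foldr max 0) := by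
  rw [fast, dif_neg h]
  simp

lemma slow_of_ne_nil {w : List ℕ} (h : w ≠ []) :
    slow w = slow (blocks (w.foldr max 0) w).headI ++
      ((blocks (w.foldr max 0) w).tail.map fun A => slow A ++ [w.foldr max 0]).flatten := by
  rw [slow, dif_neg h]
  congr 2
  exact List.attach_map_val (l := (blocks (w.foldr max 0) w).tail)
    (f := fun A => slow A ++ [w.foldr max 0])

lemma fast_nil : fast [] = [] := by rw [fast, dif_pos rfl]

lemma slow_nil : slow [] = [] := by rw [slow, dif_pos rfl]

lemma length_lt_of_mem_blocks {w A : List ℕ} (h : w ≠ [])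
    (hA : A ∈ blocks (w.foldr max 0) w) : A.length < w.length := by
  have h1 := blocks_length hA
  have h2 := List.count_pos_iff.mpr (foldr_max_mem h)
  omega

lemma fast_perm (w : List ℕ) : (fast w).Perm w := by
  induction hk : w.length using Nat.strong_induction_on generalizing w with
  | _ k ih =>
    subst hk
    rcases eq_or_ne w [] with rfl | h
    · simp [fast_nil]
    · rw [fast_of_ne_nil h]
      refine List.Perm.trans (List.Perm.append_right _ ?_) (flatten_blocks_perm _ w)
      simpa using flatten_map_perm (f := fast) (g := id)
        fun A hA => ih _ (length_lt_of_mem_blocks h hA) A rfl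

lemma slow_perm (w : List ℕ) : (slow w).Perm w := by
  induction hk : w.length using Nat.strong_induction_on generalizing w with
  | _ k ih =>
    subst hk
    rcases eq_or_ne w [] with rfl | h
    · simp [slow_nil]
    · rw [slow_of_ne_nil h]
      refine List.Perm.trans (List.Perm.append ?_ ?_)
        (headI_append_flatten_tail_blocks_perm (w.foldr max 0) w)
      · exact ih _ (length_lt_of_mem_blocks h (headI_mem (blocks_ne_nil _ _))) _ rfl
      · exact flatten_map_perm fun A hA => List.Perm.append_right _
          (ih _ (length_lt_of_mem_blocks h (List.mem_of_mem_tail hA)) A rfl)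

lemma isStackSort_fast : IsStackSort fast where
  nil := fast_nil
  perm := fast_perm
  append_cons {A B n} hA hB := by
    have hA' : n ∉ A := fun h => (hA n h).false
    have hB' : n ∉ B := fun h => (hB n h).false
    rw [fast_of_ne_nil (by simp), foldr_max_append_cons hA hB, blocks_append_cons hA',
      blocks_of_notMem hB']
    simp [List.count_eq_zero_of_not_mem hA', List.count_eq_zero_of_not_mem hB']
  concat_max {w} h := by
    obtain ⟨c, hc⟩ := Nat.exists_eq_succ_of_ne_zero
      (List.count_pos_iff.mpr (foldr_max_mem h)).ne'
    rw [fast_of_ne_nil h, hc, List.replicate_succ', ← List.append_assoc]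
    exact ⟨_, rfl⟩
  pair a := by
    rw [fast_of_ne_nil (by simp)]
    simp [blocks, fast_nil, List.replicate]

lemma isStackSort_slow : IsStackSort slow where
  nil := slow_nil
  perm := slow_perm
  append_cons {A B n} hA hB := by
    have hA' : n ∉ A := fun h => (hA n h).false
    have hB' : n ∉ B := fun h => (hB n h).false
    rw [slow_of_ne_nil (by simp), foldr_max_append_cons hA hB, blocks_append_cons hA',
      blocks_of_notMem hB']
    simp
  concat_max {w} h := by
    rw [slow_of_ne_nil h]
    have h1 := List.count_pos_iff.mpr (foldr_max_mem h)
    have h2 := length_blocks (w.foldr max 0) w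
    rcases List.eq_nil_or_concat (blocks (w.foldr max 0) w).tail with h3 | ⟨t, c, h3⟩
    · have := congrArg List.length h3
      simp only [List.length_tail, List.length_nil] at this
      omega
    · rw [h3]
      simp only [List.concat_eq_append, List.map_append, List.flatten_append, List.map_cons,
        List.map_nil, List.flatten_cons, List.flatten_nil, List.append_nil, ← List.append_assoc]
      exact ⟨_, rfl⟩
  pair a := by
    rw [slow_of_ne_nil (by simp)]
    simp [blocks, slow_nil]

/-- The word `a (a-1) ⋯ 2 1 1 L`. -/
def descWord (a : ℕ) (L : List ℕ) : List ℕ :=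
  ((List.range a).map fun i => a - i) ++ 1 :: L

lemma map_range_succ_sub (a : ℕ) :
    ((List.range (a + 1)).map fun i => a + 1 - i) =
      (a + 1) :: (List.range a).map fun i => a - i := by
  rw [List.range_succ_eq_map]
  simp

lemma descWord_succ (a : ℕ) (L : List ℕ) :
    descWord (a + 1) L = (a + 1) :: descWord a L := by
  rw [descWord, map_range_succ_sub]; rfl

lemma mem_descWord {a x : ℕ} {L : List ℕ} (h : x ∈ descWord a L) : x ≤ a ∨ x = 1 ∨ x ∈ L := by
  simp only [descWord, List.mem_append, List.mem_map, List.mem_cons] at h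
  rcases h with ⟨i, -, rfl⟩ | h
  · left; omega
  · exact Or.inr h

lemma descWord_concat (a n : ℕ) (L : List ℕ) : descWord a (L ++ [n]) = descWord a L ++ [n] := by
  simp [descWord]

/-- The suffix `L` of `descWord a L` is increasing and consists of letters larger than all the
preceding ones. -/
def IsTail (a : ℕ) (L : List ℕ) : Prop :=
  L.Pairwise (· < ·) ∧ ∀ x ∈ L, a < x ∧ 1 < x

lemma IsTail.mono {a b : ℕ} {L L' : List ℕ} (h : IsTail a L) (hab : b ≤ a) (hL : L'.Sublist L) :
    IsTail b L' :=
  ⟨h.1.sublist hL, fun x hx => ⟨hab.trans_lt (h.2 x (hL.subset hx)).1, (h.2 x (hL.subset hx)).2⟩⟩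

lemma IsTail.lt_of_mem_descWord {a n x : ℕ} {L : List ℕ} (h : IsTail a (L ++ [n]))
    (hx : x ∈ descWord a L) : x < n := by
  have hn := h.2 n (by simp)
  rcases mem_descWord hx with hx | rfl | hx
  · omega
  · exact hn.2
  · exact (List.pairwise_append.1 h.1).2.2 x hx n (by simp)

namespace IsStackSort

variable {S : List ℕ → List ℕ}

lemma eq_nil_iff (hS : IsStackSort S) {w : List ℕ} : S w = [] ↔ w = [] := by
  refine ⟨fun h => ?_, fun h => h ▸ hS.nil⟩
  have := hS.perm w
  rw [h] at this
  exact this.nil_eq.symm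

lemma le_of_eq_concat (hS : IsStackSort S) {u v : List ℕ} {x y : ℕ} (h : S u = v ++ [x])
    (hy : y ∈ v) : y ≤ x := by
  have hu : u ≠ [] := by
    rintro rfl
    simp [hS.nil] at h
  obtain ⟨v', hv'⟩ := hS.concat_max hu
  obtain ⟨rfl, hx⟩ := List.append_inj' (h.symm.trans hv') rfl
  have hx : x = u.foldr max 0 := by simpa using hx
  rw [hx]
  exact le_foldr_max ((hS.perm u).subset (by simp [h, hy]))

lemma eq_singleton_iff (hS : IsStackSort S) {u : List ℕ} {a : ℕ} : S u = [a] ↔ u = [a] := by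
  constructor
  · intro h
    have := hS.perm u
    rw [h] at this
    exact List.perm_singleton.1 this.symm
  · rintro rfl
    have := hS.append_cons (A := []) (B := []) (n := a) (by simp) (by simp)
    simpa [hS.nil] using this

lemma eq_pair_iff (hS : IsStackSort S) {u : List ℕ} {a : ℕ} : S u = [a, a] ↔ u = [a, a] := by
  constructor
  · intro h
    have := hS.perm u
    rw [h] at this
    exact (List.perm_replicate (n := 2)).1 this.symm
  · rintro rfl
    exact hS.pair a

lemma eq_concat_iff (hS : IsStackSort S) {u w : List ℕ} {n : ℕ} (hw : ∀ x ∈ w, x < n) :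
    S u = w ++ [n] ↔ ∃ A B, S A ++ S B = w ∧ u = A ++ n :: B := by
  constructor
  · intro h
    have hp : (w ++ [n]).Perm u := h ▸ hS.perm u
    obtain ⟨A, B, rfl⟩ := List.append_of_mem (hp.subset (by simp : n ∈ w ++ [n]))
    have hp' : (A ++ B).Perm w :=
      ((List.perm_middle.symm.trans hp.symm).trans (List.perm_append_singleton n w)).cons_inv
    have := hS.append_cons (A := A) (B := B) (n := n)
      (fun x hx => hw x (hp'.subset (by simp [hx])))
      (fun x hx => hw x (hp'.subset (by simp [hx])))
    exact ⟨A, B, (List.append_inj' (this.symm.trans h) rfl).1, rfl⟩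
  · rintro ⟨A, B, rfl, rfl⟩
    refine hS.append_cons (fun x hx => hw x ?_) (fun x hx => hw x ?_)
    · simp [(hS.perm A).mem_iff, hx]
    · simp [(hS.perm B).mem_iff, hx]

lemma append_eq_descWord_cases (hS : IsStackSort S) {A B L : List ℕ} {a : ℕ}
    (h : S A ++ S B = descWord (a + 1) L) :
    (A = [] ∧ S B = descWord (a + 1) L) ∨ (B = [] ∧ S A = descWord (a + 1) L) ∨
    (A = [a + 1] ∧ S B = descWord a L) ∨
    ∃ L' L'', L = L' ++ L'' ∧ L'' ≠ [] ∧ S A = descWord (a + 1) L' := by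
  rcases eq_or_ne A [] with rfl | hA
  · left; simpa [hS.nil] using h
  rcases eq_or_ne B [] with rfl | hB
  · right; left; simpa [hS.nil] using h
  right; right
  have hB' : S B ≠ [] := fun h => hB (hS.eq_nil_iff.1 h)
  obtain ⟨c, t, hct⟩ := List.exists_cons_of_ne_nil fun h => hA (hS.eq_nil_iff.1 h)
  rw [hct, descWord_succ, List.cons_append, List.cons.injEq] at h
  obtain ⟨rfl, h⟩ := h
  rcases List.eq_nil_or_concat t with rfl | ⟨v, x, rfl⟩
  · left
    exact ⟨hS.eq_singleton_iff.1 hct, h⟩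
  right
  rw [List.concat_eq_append] at h hct
  have hx : a + 1 ≤ x := hS.le_of_eq_concat (v := (a + 1) :: v) hct (by simp)
  have hxD : x ∉ (List.range a).map fun i => a - i := by
    simp only [List.mem_map, not_exists]
    rintro i ⟨-, hi⟩
    omega
  rw [descWord, List.append_eq_append_iff] at h
  rcases h with ⟨r, hr, -⟩ | ⟨r, hr, hr'⟩
  · exact absurd (by rw [hr]; simp) hxD
  · cases r with
    | nil => exact absurd (by rw [List.append_nil] at hr; rw [← hr]; simp) hxD
    | cons d r =>
      simp only [List.cons_append, List.cons.injEq] at hr'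
      obtain ⟨rfl, hr'⟩ := hr'
      refine ⟨r, S B, hr', hB', ?_⟩
      rw [hct, hr, descWord_succ, descWord]

lemma ne_descWord (hS : IsStackSort S) {a : ℕ} {L : List ℕ} (hL : IsTail a L)
    (h : L.length + 1 < a) (u : List ℕ) : S u ≠ descWord a L := by
  induction hk : L.length using Nat.strong_induction_on generalizing a L u with
  | _ k ih =>
    subst hk
    intro hu
    obtain ⟨a, rfl⟩ := Nat.exists_eq_succ_of_ne_zero (by omega : a ≠ 0)
    rcases List.eq_nil_or_concat L with rfl | ⟨L, n, rfl⟩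
    · have := hS.le_of_eq_concat (y := a + 1) hu (by simp [map_range_succ_sub])
      simp at h
      omega
    · rw [List.concat_eq_append] at hL hu ih h
      rw [List.length_append, List.length_singleton] at ih h
      rw [descWord_concat, hS.eq_concat_iff fun x => hL.lt_of_mem_descWord] at hu
      obtain ⟨A, B, hAB, -⟩ := hu
      have hL' := hL.mono le_rfl (List.sublist_append_left L [n])
      rcases hS.append_eq_descWord_cases hAB with ⟨-, h'⟩ | ⟨-, h'⟩ | ⟨-, h'⟩ | ⟨L', L'', rfl, -, h'⟩
      · exact ih _ (by omega) hL' (by omega) _ rfl h'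
      · exact ih _ (by omega) hL' (by omega) _ rfl h'
      · exact ih _ (by omega) (hL'.mono (by omega) (List.Sublist.refl _)) (by omega) _ rfl h'
      · rw [List.length_append] at ih h
        exact ih L'.length (by omega) (hL'.mono le_rfl (List.sublist_append_left _ _))
          (by omega) _ rfl h'

lemma setOf_eq_descWord_concat (hS : IsStackSort S) {a n : ℕ} {L : List ℕ}
    (hL : IsTail (a + 1) (L ++ [n])) (h : L.length ≤ a) :
    {u | S u = descWord (a + 1) (L ++ [n])} =
      (fun B => n :: B) '' {u | S u = descWord (a + 1) L} ∪
      (fun A => A ++ [n]) '' {u | S u = descWord (a + 1) L} ∪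
      (fun B => (a + 1) :: n :: B) '' {u | S u = descWord a L} := by
  ext u
  simp only [Set.mem_ofPred_eq, Set.mem_union, Set.mem_image]
  rw [descWord_concat, hS.eq_concat_iff fun x => hL.lt_of_mem_descWord]
  constructor
  · rintro ⟨A, B, hAB, rfl⟩
    rcases hS.append_eq_descWord_cases hAB with
      ⟨rfl, h'⟩ | ⟨rfl, h'⟩ | ⟨rfl, h'⟩ | ⟨L', L'', rfl, hL'', h'⟩
    · exact Or.inl (Or.inl ⟨B, h', rfl⟩)
    · exact Or.inl (Or.inr ⟨A, h', rfl⟩)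
    · exact Or.inr ⟨B, h', rfl⟩
    · rw [List.length_append] at h
      have := List.length_pos_iff.2 hL''
      refine absurd h' (hS.ne_descWord (hL.mono le_rfl ?_) (by omega) A)
      rw [List.append_assoc]
      exact List.sublist_append_left _ _
  · rintro ((⟨B, h', rfl⟩ | ⟨A, h', rfl⟩) | ⟨B, h', rfl⟩)
    · exact ⟨[], B, by simp [hS.nil, h'], rfl⟩
    · exact ⟨A, [], by simp [hS.nil, h'], rfl⟩
    · exact ⟨[a + 1], B, by simp [hS.eq_singleton_iff.2 rfl, h', descWord_succ], rfl⟩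

lemma encard_eq_one (hS : IsStackSort S) {a : ℕ} {L : List ℕ} (hL : IsTail (a + 1) L)
    (h : L.length = a) : {u | S u = descWord (a + 1) L}.encard = 1 := by
  induction a generalizing L with
  | zero =>
    obtain rfl := List.length_eq_zero_iff.1 h
    have : {u | S u = descWord (0 + 1) []} = {[1, 1]} := by
      ext u
      exact hS.eq_pair_iff
    rw [this, Set.encard_singleton]
  | succ a ih =>
    rcases List.eq_nil_or_concat L with rfl | ⟨L, n, rfl⟩
    · simp at h
    rw [List.concat_eq_append] at hL h ⊢
    rw [List.length_append, List.length_singleton] at h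
    have hL' := List.sublist_append_left L [n]
    have hempty : {u | S u = descWord (a + 1 + 1) L} = ∅ :=
      Set.eq_empty_of_forall_notMem
        (hS.ne_descWord (hL.mono le_rfl hL') (by omega))
    rw [hS.setOf_eq_descWord_concat hL (by omega), hempty]
    simp only [Set.image_empty, Set.empty_union]
    rw [Function.Injective.encard_image (fun B B' h => by simpa using h)]
    exact ih (hL.mono (by omega) hL') (by omega)

lemma encard_eq_two_mul_add_one (hS : IsStackSort S) {a : ℕ} {L : List ℕ} (hL : IsTail a L)
    (h : L.length = a) : {u | S u = descWord a L}.encard = (2 * a + 1 : ℕ) := by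
  induction a generalizing L with
  | zero =>
    obtain rfl := List.length_eq_zero_iff.1 h
    have : {u | S u = descWord 0 []} = {[1]} := by
      ext u
      exact hS.eq_singleton_iff
    rw [this, Set.encard_singleton]
    rfl
  | succ a ih =>
    rcases List.eq_nil_or_concat L with rfl | ⟨L, n, rfl⟩
    · simp at h
    rw [List.concat_eq_append] at hL h ⊢
    rw [List.length_append, List.length_singleton] at h
    have hL' := List.sublist_append_left L [n]
    have hn : ∀ {u}, S u = descWord (a + 1) L → n ∉ u := fun {u} hu hmem =>
      (hL.lt_of_mem_descWord (hu ▸ (hS.perm u).mem_iff.2 hmem)).false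
    have han := (hL.2 n (by simp)).1
    have hd : Disjoint ((fun B => n :: B) '' {u | S u = descWord (a + 1) L})
        ((fun A => A ++ [n]) '' {u | S u = descWord (a + 1) L}) := by
      rw [Set.disjoint_left]
      rintro _ ⟨B, hB, rfl⟩ ⟨A, hA, hAB⟩
      cases A with
      | nil => simp [hS.nil, descWord] at hA
      | cons c A =>
        simp only [List.cons_append, List.cons.injEq] at hAB
        exact hn hA (by simp [hAB.1])
    have hd' : Disjoint ((fun B => n :: B) '' {u | S u = descWord (a + 1) L} ∪
        (fun A => A ++ [n]) '' {u | S u = descWord (a + 1) L})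
        ((fun B => (a + 1) :: n :: B) '' {u | S u = descWord a L}) := by
      rw [Set.disjoint_left]
      rintro _ (⟨B, hB, rfl⟩ | ⟨A, hA, rfl⟩) ⟨B', hB', hAB⟩
      · simp only [List.cons.injEq] at hAB
        omega
      · have hB0 : B' = [] := by
          rcases List.eq_nil_or_concat B' with h0 | ⟨t, x, rfl⟩
          · exact h0
          · exfalso
            rw [List.concat_eq_append] at hAB
            have := (List.append_inj' (s₁ := (a + 1) :: n :: t) hAB rfl).1
            exact hn hA (by simp [← this])
        subst hB0
        simp [hS.nil, descWord] at hB'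
    rw [hS.setOf_eq_descWord_concat hL (by omega), Set.encard_union_eq hd', Set.encard_union_eq hd,
      Function.Injective.encard_image (fun B B' h => by simpa using h),
      Function.Injective.encard_image (fun B B' h => by simpa using h),
      Function.Injective.encard_image (fun B B' h => by simpa using h),
      hS.encard_eq_one (hL.mono le_rfl hL') (by omega), ih (hL.mono (by omega) hL') (by omega)]
    norm_cast
    omega

lemma encard_xiWord (hS : IsStackSort S) (m : ℕ) (hm : 1 ≤ m) :
    {u | S u = xiWord m}.encard = (2 * m + 1 : ℕ) := by
  refine hS.encard_eq_two_mul_add_one (L := (List.range m).map fun i => m + 1 + i)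
    ⟨?_, ?_⟩ (by simp)
  · exact List.pairwise_lt_range.map _ fun i j hij => by omega
  · simp only [List.mem_map]
    rintro _ ⟨i, -, rfl⟩
    omega

end IsStackSort

/-- For every integer `m ≥ 1`, the number of words `u` with `fast u = ξ'_m` and the
number of words `u` with `slow u = ξ'_m` are both equal to `2m + 1`. -/
theorem xi_fertility (m : ℕ) (hm : 1 ≤ m) :
    {u : List ℕ | fast u = xiWord m}.Finite ∧
    {u : List ℕ | slow u = xiWord m}.Finite ∧
    {u : List ℕ | fast u = xiWord m}.ncard = 2 * m + 1 ∧
    {u : List ℕ | slow u = xiWord m}.ncard = 2 * m + 1 := by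
  have hf := isStackSort_fast.encard_xiWord m hm
  have hs := isStackSort_slow.encard_xiWord m hm
  exact ⟨Set.finite_of_encard_eq_coe hf, Set.finite_of_encard_eq_coe hs,
    by rw [Set.ncard, hf, ENat.toNat_natCast], by rw [Set.ncard, hs, ENat.toNat_natCast]⟩
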